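/- arXiv:1608.06069 — 2 statements merged into one kernel-verified Lean document; each statement's English description precedes it below -/
import Mathlib

section
/- Let C_n, C_∞, C̃_∞ ∈ (ℝ²)*⊗(ℝ²)*⊗ℝ² and let (a_n, b_n) ∈ ℝ² with b_n ≠ 0 for all n. Suppose C_n → C_∞ and M_{a_n,b_n}·C_n → C̃_∞ as n → ∞, and suppose that both symmetric matrices ρ_{s,C_∞} and ρ_{s,C̃_∞} are nondegenerate (nonzero determinant). Then there is a subsequence along which (a_n, b_n) converges to some (a, b) ∈ ℝ² with b ≠ 0. (The action of the shear-dilation group on Type B structures with nondegenerate symmetric Ricci tensor is proper.) -/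
open scoped BigOperators
open Matrix

/-- The Ricci matrix `ρ_C` of the Type B connection with Christoffel symbols
`Γ_{ij}{}^k = C_{ij}{}^k/x¹` (evaluated at `x¹ = 1`; indices are 0-based, so
`C 0 0 0 = C₁₁¹`, etc.). -/
noncomputable def rhoC (C : Fin 2 → Fin 2 → Fin 2 → ℝ) : Matrix (Fin 2) (Fin 2) ℝ :=
  !![(C 0 0 0 - C 0 1 1 + 1) * C 1 0 1 + C 0 0 1 * (C 1 1 1 - C 1 0 0),
     C 1 1 1 + C 0 1 0 * C 1 0 1 - C 0 0 1 * C 1 1 0;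
     -C 1 0 0 + C 0 1 0 * C 1 0 1 - C 0 0 1 * C 1 1 0,
     (C 0 0 0 - C 0 1 1 - 1) * C 1 1 0 + C 0 1 0 * (C 1 1 1 - C 1 0 0)]

/-- The symmetric Ricci matrix `ρ_{s,C} = (ρ_C + ρ_Cᵀ)/2`. -/
noncomputable def rhoS (C : Fin 2 → Fin 2 → Fin 2 → ℝ) : Matrix (Fin 2) (Fin 2) ℝ :=
  (1 / 2 : ℝ) • (rhoC C + (rhoC C)ᵀ)
/-- The shear-dilation matrix `M_{a,b}`, i.e. the linear map with
`M e₁ = e₁ + a e₂` and `M e₂ = b e₂` (corresponding to the coordinate change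
`(x¹,x²) ↦ (x¹, a x¹ + b x²)`). -/
noncomputable def Mab (a b : ℝ) : Matrix (Fin 2) (Fin 2) ℝ := !![1, 0; a, b]

/-- The natural tensor action of an invertible matrix `M` on
`C ∈ (ℝ²)* ⊗ (ℝ²)* ⊗ ℝ²`: the two covariant slots transform by `M⁻¹` and the
contravariant slot by `M`. -/
noncomputable def tensorAct (M : Matrix (Fin 2) (Fin 2) ℝ)
    (C : Fin 2 → Fin 2 → Fin 2 → ℝ) : Fin 2 → Fin 2 → Fin 2 → ℝ :=
  fun i j k => ∑ p : Fin 2, ∑ q : Fin 2, ∑ r : Fin 2,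
    M⁻¹ p i * M⁻¹ q j * M k r * C p q r

theorem inv_Mab (a : ℝ) {b : ℝ} (hb : b ≠ 0) : (Mab a b)⁻¹ = !![1, 0; -a / b, b⁻¹] := by
  apply Matrix.inv_eq_right_inv
  ext i j
  fin_cases i <;> fin_cases j <;> simp [Mab, Matrix.mul_apply, Fin.sum_univ_two]
  all_goals field_simp
  all_goals ring

/-- The symmetric Ricci determinant is a relative invariant of weight `b⁻²`. -/
theorem det_rhoS_tensorAct (a : ℝ) {b : ℝ} (hb : b ≠ 0) (C : Fin 2 → Fin 2 → Fin 2 → ℝ) :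
    b ^ 2 * (rhoS (tensorAct (Mab a b) C)).det = (rhoS C).det := by
  simp only [rhoS, rhoC, tensorAct, inv_Mab a hb]
  simp [Mab, Fin.sum_univ_two, Matrix.det_fin_two]
  field_simp
  ring

theorem continuous_det_rhoS : Continuous fun C => (rhoS C).det := by
  simp only [rhoS, rhoC]
  simp only [Matrix.det_fin_two, Matrix.smul_apply, Matrix.add_apply, Matrix.transpose_apply,
    Matrix.of_apply, Matrix.cons_val', Matrix.cons_val_zero, Matrix.cons_val_one,
    Matrix.cons_val_fin_one, smul_eq_mul]
  fun_prop

theorem tensorAct_Mab_relations {a b : ℝ} (ha : a ≠ 0) (hb : b ≠ 0)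
    (C : Fin 2 → Fin 2 → Fin 2 → ℝ) :
    let T := tensorAct (Mab a b) C
    let s := b * a⁻¹
    C 1 1 0 = s * s * (T 0 0 0 - C 0 0 0) + s * (C 0 1 0 + C 1 0 0) ∧
    C 1 0 0 + C 1 1 1 = -s * (T 0 0 0 - C 0 0 0 + T 0 1 1 - C 0 1 1) ∧
    C 0 1 0 + C 1 1 1 = -s * (T 0 0 0 - C 0 0 0 + T 1 0 1 - C 1 0 1) ∧
    C 1 1 1 = s * (a⁻¹ * T 0 0 1 - s * C 0 0 1 - (T 0 0 0 - C 0 1 1 - C 1 0 1)) := by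
  simp only [tensorAct, inv_Mab a hb]
  simp [Mab, Fin.sum_univ_two]
  refine ⟨?_, ?_, ?_, ?_⟩ <;> field_simp <;> ring

theorem det_rhoS_eq_zero {C : Fin 2 → Fin 2 → Fin 2 → ℝ} (h110 : C 1 1 0 = 0)
    (h100 : C 1 0 0 = 0) (h010 : C 0 1 0 = 0) (h111 : C 1 1 1 = 0) : (rhoS C).det = 0 := by
  simp [rhoS, rhoC, Matrix.det_fin_two, h110, h100, h010, h111]

/-- If the dilation parameters stay bounded while the shear parameters diverge, the limit
structure has degenerate symmetric Ricci tensor. -/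
theorem det_rhoS_eq_zero_of_tendsto_abs_shear_atTop {Cseq : ℕ → Fin 2 → Fin 2 → Fin 2 → ℝ}
    {Cinf Ctinf : Fin 2 → Fin 2 → Fin 2 → ℝ} {a b : ℕ → ℝ} (hb : ∀ n, b n ≠ 0)
    (hC : Filter.Tendsto Cseq Filter.atTop (nhds Cinf))
    (hCt : Filter.Tendsto (fun n => tensorAct (Mab (a n) (b n)) (Cseq n))
      Filter.atTop (nhds Ctinf))
    (ha : Filter.Tendsto (fun n => |a n|) Filter.atTop Filter.atTop)
    {B : ℝ} (hB : ∀ᶠ n in Filter.atTop, |b n| ≤ B) : (rhoS Cinf).det = 0 := by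
  have lim (i j k : Fin 2) :
      Filter.Tendsto (fun n => Cseq n i j k) Filter.atTop (nhds (Cinf i j k)) :=
    ((hC.apply_nhds i).apply_nhds j).apply_nhds k
  have limT (i j k : Fin 2) : Filter.Tendsto
      (fun n => tensorAct (Mab (a n) (b n)) (Cseq n) i j k) Filter.atTop
      (nhds (Ctinf i j k)) :=
    ((hCt.apply_nhds i).apply_nhds j).apply_nhds k
  have he : Filter.Tendsto (fun n => (a n)⁻¹) Filter.atTop (nhds 0) := by
    rw [tendsto_zero_iff_abs_tendsto_zero]
    simpa [Function.comp_def, abs_inv] using tendsto_inv_atTop_zero.comp ha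
  have hs : Filter.Tendsto (fun n => b n * (a n)⁻¹) Filter.atTop (nhds 0) := by
    exact bdd_le_mul_tendsto_zero' B hB he
  have hrel : ∀ᶠ n in Filter.atTop, a n ≠ 0 := by
    filter_upwards [ha.eventually_gt_atTop 0] with n hn
    exact abs_pos.mp hn
  have h111 : Cinf 1 1 1 = 0 := by
    refine tendsto_nhds_unique (lim 1 1 1) (Filter.Tendsto.congr' ?_ (by
      simpa using hs.mul (((he.mul (limT 0 0 1)).sub (hs.mul (lim 0 0 1))).sub
        (((limT 0 0 0).sub (lim 0 1 1)).sub (lim 1 0 1)))))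
    filter_upwards [hrel] with n hn
    exact (tensorAct_Mab_relations hn (hb n) (Cseq n)).2.2.2.symm
  have h010 : Cinf 0 1 0 + Cinf 1 1 1 = 0 := by
    refine tendsto_nhds_unique ((lim 0 1 0).add (lim 1 1 1)) (Filter.Tendsto.congr' ?_ (by
      simpa using hs.neg.mul ((((limT 0 0 0).sub (lim 0 0 0)).add (limT 1 0 1)).sub (lim 1 0 1))))
    filter_upwards [hrel] with n hn
    simpa using (tensorAct_Mab_relations hn (hb n) (Cseq n)).2.2.1.symm
  have h100 : Cinf 1 0 0 + Cinf 1 1 1 = 0 := by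
    refine tendsto_nhds_unique ((lim 1 0 0).add (lim 1 1 1)) (Filter.Tendsto.congr' ?_ (by
      simpa using hs.neg.mul ((((limT 0 0 0).sub (lim 0 0 0)).add (limT 0 1 1)).sub (lim 0 1 1))))
    filter_upwards [hrel] with n hn
    simpa using (tensorAct_Mab_relations hn (hb n) (Cseq n)).2.1.symm
  have h110 : Cinf 1 1 0 = 0 := by
    refine tendsto_nhds_unique (lim 1 1 0) (Filter.Tendsto.congr' ?_ (by
      simpa using ((hs.mul hs).mul ((limT 0 0 0).sub (lim 0 0 0))).add
        (hs.mul ((lim 0 1 0).add (lim 1 0 0)))))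
    filter_upwards [hrel] with n hn
    exact (tensorAct_Mab_relations hn (hb n) (Cseq n)).1.symm
  exact det_rhoS_eq_zero h110 (by linarith) (by linarith) h111

/-- Properness of the shear-dilation action on Type B structures with nondegenerate
symmetric Ricci tensor: if `C_n → C_∞`, `M_{a_n,b_n}·C_n → C̃_∞`, and both
`ρ_{s,C_∞}` and `ρ_{s,C̃_∞}` are nondegenerate, then some subsequence of
`(a_n, b_n)` converges to a limit `(a, b)` with `b ≠ 0`. -/
theorem shear_dilation_action_proper (Cseq : ℕ → Fin 2 → Fin 2 → Fin 2 → ℝ)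
    (Cinf Ctinf : Fin 2 → Fin 2 → Fin 2 → ℝ) (a b : ℕ → ℝ) (hb : ∀ n, b n ≠ 0)
    (hC : Filter.Tendsto Cseq Filter.atTop (nhds Cinf))
    (hCt : Filter.Tendsto (fun n => tensorAct (Mab (a n) (b n)) (Cseq n))
      Filter.atTop (nhds Ctinf))
    (h1 : (rhoS Cinf).det ≠ 0) (h2 : (rhoS Ctinf).det ≠ 0) :
    ∃ φ : ℕ → ℕ, StrictMono φ ∧ ∃ a₀ b₀ : ℝ, b₀ ≠ 0 ∧
      Filter.Tendsto (fun k => (a (φ k), b (φ k))) Filter.atTop (nhds (a₀, b₀)) := by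
  set L := (rhoS Cinf).det / (rhoS Ctinf).det with hL
  have hL0 : L ≠ 0 := div_ne_zero h1 h2
  have hdetT := (continuous_det_rhoS.tendsto Ctinf).comp hCt
  have hb2 : Filter.Tendsto (fun n => b n ^ 2) Filter.atTop (nhds L) := by
    refine (((continuous_det_rhoS.tendsto Cinf).comp hC).div hdetT h2).congr' ?_
    filter_upwards [hdetT.eventually_ne h2] with n hn
    exact (eq_div_of_mul_eq hn (det_rhoS_tensorAct (a n) (hb n) (Cseq n))).symm
  have hB : ∀ᶠ n in Filter.atTop, |b n| ≤ Real.sqrt (L + 1) := by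
    filter_upwards [hb2.eventually_le_const (lt_add_one L)] with n hn
    exact Real.abs_le_sqrt hn
  by_cases ha : Filter.Tendsto (fun n => |a n|) Filter.atTop Filter.atTop
  · exact absurd (det_rhoS_eq_zero_of_tendsto_abs_shear_atTop hb hC hCt ha hB) h1
  · obtain ⟨R, hR⟩ : ∃ R, ∃ᶠ n in Filter.atTop, |a n| < R := by
      simpa only [Filter.tendsto_atTop, not_forall, Filter.not_eventually, not_le] using ha
    have hfreq : ∃ᶠ n in Filter.atTop, (a n, b n) ∈
        Set.Icc (-R) R ×ˢ Set.Icc (-Real.sqrt (L + 1)) (Real.sqrt (L + 1)) :=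
      (hR.and_eventually hB).mono fun n hn => ⟨abs_le.mp hn.1.le, abs_le.mp hn.2⟩
    obtain ⟨⟨a₀, b₀⟩, -, φ, hφ, hlim⟩ :=
      (isCompact_Icc.prod isCompact_Icc).tendsto_subseq' hfreq
    refine ⟨φ, hφ, a₀, b₀, ?_, hlim⟩
    rintro rfl
    have hb0 : Filter.Tendsto (fun k => b (φ k)) Filter.atTop (nhds 0) := hlim.snd_nhds
    refine hL0 (tendsto_nhds_unique (hb2.comp hφ.tendsto_atTop) ?_)
    simpa [Function.comp_def] using hb0.pow 2
end

section
/- Let C ∈ (ℝ²)*⊗(ℝ²)*⊗ℝ² satisfy ρ_{s,C} = λ·diag(1,−1) for some λ ≠ 0 (Lorentzian-signature symmetric Ricci tensor in normal form), and assume C ≠ C₋. Then for any point P ∈ ℝ⁺×ℝ, any smooth vector field X defined on a connected open neighborhood of P in ℝ⁺×ℝ which satisfies the affine Killing equation for ∇^C is of the form X = α(x¹∂_{x¹} + x²∂_{x²}) + β∂_{x²} for constants α, β ∈ ℝ. -/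
open scoped BigOperators
open Matrix

/-- The partial derivative `∂_{x^i} f` of a function on `ℝ²`. -/
noncomputable def pd (i : Fin 2) (f : ℝ × ℝ → ℝ) : ℝ × ℝ → ℝ :=
  fun p => fderiv ℝ f p (if i = 0 then (1, 0) else (0, 1))

/-- The Christoffel symbols `Γ_{ij}{}^k = C_{ij}{}^k/x¹` of the Type B connection `∇^C`. -/
noncomputable def Gam (C : Fin 2 → Fin 2 → Fin 2 → ℝ) (i j k : Fin 2) : ℝ × ℝ → ℝ :=
  fun p => C i j k / p.1

/-- The affine Killing equation for a vector field `X = X¹∂₁ + X²∂₂` (components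
`fun p => X p l`) with respect to the Type B connection `∇^C`, at the point `p`:
`∂_i∂_j X^l + Σ_k (X^k ∂_k Γ_{ij}{}^l + Γ_{kj}{}^l ∂_i X^k + Γ_{ik}{}^l ∂_j X^k
  − Γ_{ij}{}^k ∂_k X^l) = 0` for all `i j l`. -/
noncomputable def IsAffineKillingAt (C : Fin 2 → Fin 2 → Fin 2 → ℝ)
    (X : ℝ × ℝ → Fin 2 → ℝ) (p : ℝ × ℝ) : Prop :=
  ∀ i j l : Fin 2,
    pd i (pd j fun q => X q l) p
      + ∑ k : Fin 2,
          (X p k * pd k (Gam C i j l) p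
            + Gam C k j l p * pd i (fun q => X q k) p
            + Gam C i k l p * pd j (fun q => X q k) p
            - Gam C i j k p * pd k (fun q => X q l) p) = 0

/-- The Christoffel constants `C₋` of the Lorentzian hyperbolic metric
`g₋ = ((dx¹)² − (dx²)²)/(x¹)²`: `C₁₁¹ = C₁₂² = C₂₁² = −1`, `C₂₂¹ = −1`,
all other components `0` (0-based indices). -/
noncomputable def Cminus : Fin 2 → Fin 2 → Fin 2 → ℝ :=
  ![![![-1, 0], ![0, -1]], ![![0, -1], ![-1, 0]]]

lemma contDiffOn_pd {U : Set (ℝ × ℝ)} (hU : IsOpen U) {f : ℝ × ℝ → ℝ}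
    (hf : ContDiffOn ℝ (⊤ : ℕ∞) f U) (i : Fin 2) : ContDiffOn ℝ (⊤ : ℕ∞) (pd i f) U :=
  (hf.fderiv_of_isOpen hU (m := (⊤ : ℕ∞)) (by simp)).clm_apply contDiffOn_const

lemma differentiableAt_of_contDiffOn {U : Set (ℝ × ℝ)} (hU : IsOpen U) {f : ℝ × ℝ → ℝ}
    (hf : ContDiffOn ℝ (⊤ : ℕ∞) f U) {p : ℝ × ℝ} (hp : p ∈ U) : DifferentiableAt ℝ f p :=
  (hf.contDiffAt (hU.mem_nhds hp)).differentiableAt (by simp)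

lemma pd_comm {U : Set (ℝ × ℝ)} (hU : IsOpen U) {f : ℝ × ℝ → ℝ}
    (hf : ContDiffOn ℝ (⊤ : ℕ∞) f U) {p : ℝ × ℝ} (hp : p ∈ U) (i j : Fin 2) :
    pd i (pd j f) p = pd j (pd i f) p := by
  have hs : IsSymmSndFDerivAt ℝ f p :=
    (hf.contDiffAt (hU.mem_nhds hp)).isSymmSndFDerivAt (by
      rw [minSmoothness_of_isRCLikeNormedField]
      exact WithTop.coe_le_coe.2 (le_top : (2 : ℕ∞) ≤ ⊤))
  have hd : DifferentiableAt ℝ (fderiv ℝ f) p :=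
    ((hf.fderiv_of_isOpen hU (m := (⊤ : ℕ∞)) (by simp)).contDiffAt
      (hU.mem_nhds hp)).differentiableAt (by simp)
  have key : ∀ i j : Fin 2, pd i (pd j f) p =
      fderiv ℝ (fderiv ℝ f) p (if i = 0 then (1, 0) else (0, 1))
        (if j = 0 then (1, 0) else (0, 1)) := by
    intro i j
    have h := fderiv_clm_apply hd
      (differentiableAt_const ((if j = 0 then (1, 0) else (0, 1)) : ℝ × ℝ))
    change fderiv ℝ (fun q => fderiv ℝ f q (if j = 0 then (1, 0) else (0, 1))) p _ = _
    rw [h]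
    simp
  rw [key, key, hs.eq]

lemma pd_congr_of_eqOn {U : Set (ℝ × ℝ)} (hU : IsOpen U) {f g : ℝ × ℝ → ℝ}
    (h : ∀ q ∈ U, f q = g q) {p : ℝ × ℝ} (hp : p ∈ U) (i : Fin 2) : pd i f p = pd i g p := by
  have : f =ᶠ[nhds p] g := Filter.eventuallyEq_of_mem (hU.mem_nhds hp) h
  simp only [pd, this.fderiv_eq]

lemma pd_fst (i : Fin 2) (p : ℝ × ℝ) : pd i Prod.fst p = if i = 0 then 1 else 0 := by
  simp only [pd, fderiv_fst]
  fin_cases i <;> simp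

lemma pd_mul {f g : ℝ × ℝ → ℝ} {p : ℝ × ℝ} (hf : DifferentiableAt ℝ f p)
    (hg : DifferentiableAt ℝ g p) (i : Fin 2) :
    pd i (fun q => f q * g q) p = f p * pd i g p + g p * pd i f p := by
  simp [pd, fderiv_fun_mul hf hg]

lemma pd_fst_sq (i : Fin 2) (p : ℝ × ℝ) :
    pd i (fun q => q.1 ^ 2) p = (if i = 0 then 1 else 0) * (2 * p.1) := by
  have h := pd_mul (f := Prod.fst) (g := Prod.fst) (p := p) differentiableAt_fst
    differentiableAt_fst i
  simp only [← pow_two, pd_fst] at h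
  rw [h]; ring

lemma pd_Gam (C : Fin 2 → Fin 2 → Fin 2 → ℝ) (i j l k : Fin 2) {p : ℝ × ℝ} (hp : 0 < p.1) :
    pd k (Gam C i j l) p = (if k = 0 then 1 else 0) * (-C i j l / p.1 ^ 2) := by
  have h : HasFDerivAt (Gam C i j l)
      ((C i j l * -(p.1 ^ 2)⁻¹) • ContinuousLinearMap.fst ℝ ℝ ℝ) p := by
    have h1 := ((hasDerivAt_inv hp.ne').const_mul (C i j l)).comp_hasFDerivAt p
      (hasFDerivAt_fst (𝕜 := ℝ) (E := ℝ) (F := ℝ) (p := p))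
    exact h1
  simp only [pd, h.fderiv]
  fin_cases k <;> simp [div_eq_mul_inv]

/-- `(x¹)²` times the affine Killing equation. -/
lemma IsAffineKillingAt.mul_sq {C : Fin 2 → Fin 2 → Fin 2 → ℝ} {X : ℝ × ℝ → Fin 2 → ℝ}
    {p : ℝ × ℝ} (h : IsAffineKillingAt C X p) (hp : 0 < p.1) (i j l : Fin 2) :
    p.1 ^ 2 * pd i (pd j fun q => X q l) p
      + p.1 * (∑ k : Fin 2, (C k j l * pd i (fun q => X q k) p
          + C i k l * pd j (fun q => X q k) p - C i j k * pd k (fun q => X q l) p))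
      - C i j l * X p 0 = 0 := by
  have h' := h i j l
  simp only [pd_Gam _ _ _ _ _ hp, Fin.sum_univ_two, Gam] at h' ⊢
  have hx := hp.ne'
  simp at h'
  field_simp at h'
  linear_combination h'

lemma pd_linear_combination {ι : Type*} [Fintype ι] {f g h : ι → ℝ × ℝ → ℝ} {p : ℝ × ℝ}
    (hf : ∀ k, DifferentiableAt ℝ (f k) p) (hg : ∀ k, DifferentiableAt ℝ (g k) p)
    (hh : ∀ k, DifferentiableAt ℝ (h k) p) (A B D : ι → ℝ) (m : Fin 2) :
    pd m (fun q => ∑ k, (A k * f k q + B k * g k q - D k * h k q)) p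
      = ∑ k, (A k * pd m (f k) p + B k * pd m (g k) p - D k * pd m (h k) p) := by
  have H := HasFDerivAt.fun_sum (u := Finset.univ) fun k _ =>
    (((hf k).hasFDerivAt.const_mul (A k)).fun_add ((hg k).hasFDerivAt.const_mul (B k))).fun_sub
      ((hh k).hasFDerivAt.const_mul (D k))
  simp only [pd, H.fderiv]
  simp

lemma pd_quadratic_combination {h u w : ℝ × ℝ → ℝ} {p : ℝ × ℝ} (hh : DifferentiableAt ℝ h p)
    (hu : DifferentiableAt ℝ u p) (hw : DifferentiableAt ℝ w p) (c : ℝ) (m : Fin 2) :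
    pd m (fun q => q.1 ^ 2 * h q + q.1 * u q - c * w q) p
      = (if m = 0 then 1 else 0) * (2 * p.1 * h p + u p)
        + p.1 ^ 2 * pd m h p + p.1 * pd m u p - c * pd m w p := by
  have h1 : DifferentiableAt ℝ (fun q : ℝ × ℝ => q.1 ^ 2 * h q) p := by fun_prop
  have h2 : DifferentiableAt ℝ (fun q : ℝ × ℝ => q.1 * u q) p := by fun_prop
  have e : pd m (fun q => q.1 ^ 2 * h q + q.1 * u q - c * w q) p
      = pd m (fun q => q.1 ^ 2 * h q) p + pd m (fun q => q.1 * u q) p - c * pd m w p := by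
    have H := (h1.hasFDerivAt.fun_add h2.hasFDerivAt).fun_sub (hw.hasFDerivAt.const_mul c)
    simp only [pd, H.fderiv]
    simp
  rw [e, pd_mul (by fun_prop) hh, pd_mul (by fun_prop) hu, pd_fst_sq,
    show pd m (fun q : ℝ × ℝ => q.1) p = _ from pd_fst m p]
  ring

/-- The derivative of `(x¹)²` times the affine Killing equation. -/
lemma pd_killing {C : Fin 2 → Fin 2 → Fin 2 → ℝ} {X : ℝ × ℝ → Fin 2 → ℝ}
    {U : Set (ℝ × ℝ)} (hU : IsOpen U) (hU1 : ∀ p ∈ U, 0 < p.1)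
    (hX : ∀ l : Fin 2, ContDiffOn ℝ (⊤ : ℕ∞) (fun q => X q l) U)
    (hkill : ∀ p ∈ U, IsAffineKillingAt C X p) {p : ℝ × ℝ} (hp : p ∈ U) (m i j l : Fin 2) :
    (if m = 0 then 1 else 0) * (2 * p.1 * pd i (pd j fun q => X q l) p
        + ∑ k : Fin 2, (C k j l * pd i (fun q => X q k) p
          + C i k l * pd j (fun q => X q k) p - C i j k * pd k (fun q => X q l) p))
      + p.1 ^ 2 * pd m (pd i (pd j fun q => X q l)) p
      + p.1 * (∑ k : Fin 2, (C k j l * pd m (pd i (fun q => X q k)) p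
          + C i k l * pd m (pd j (fun q => X q k)) p
          - C i j k * pd m (pd k (fun q => X q l)) p))
      - C i j l * pd m (fun q => X q 0) p = 0 := by
  have d1 : ∀ i k : Fin 2, DifferentiableAt ℝ (pd i fun q => X q k) p := fun i k =>
    differentiableAt_of_contDiffOn hU (contDiffOn_pd hU (hX k) i) hp
  have d2 : DifferentiableAt ℝ (pd i (pd j fun q => X q l)) p :=
    differentiableAt_of_contDiffOn hU (contDiffOn_pd hU (contDiffOn_pd hU (hX l) j) i) hp
  have h := pd_congr_of_eqOn hU (fun q hq => (hkill q hq).mul_sq (hU1 q hq) i j l) hp m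
  rw [pd_quadratic_combination d2
    (by
      have := fun k => d1 i k
      have := fun k => d1 j k
      have := fun k => d1 k l
      fun_prop)
    (differentiableAt_of_contDiffOn hU (hX 0) hp),
    pd_linear_combination (fun k => d1 i k) (fun k => d1 j k) (fun k => d1 k l)] at h
  rw [h]
  simp [pd]

/-- The component `(x¹)² R(∂₁, ∂₂)∂_j^l` of the curvature of the Type B connection `∇^C`. -/
noncomputable def curv (C : Fin 2 → Fin 2 → Fin 2 → ℝ) (j l : Fin 2) : ℝ :=
  -C 1 j l + C 0 0 l * C 1 j 0 + C 0 1 l * C 1 j 1 - C 1 0 l * C 0 j 0 - C 1 1 l * C 0 j 1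

/-- The Lie derivative of the curvature tensor along an affine Killing field vanishes. -/
lemma lieDerivative_curv {C : Fin 2 → Fin 2 → Fin 2 → ℝ} {X : ℝ × ℝ → Fin 2 → ℝ}
    {U : Set (ℝ × ℝ)} (hU : IsOpen U) (hU1 : ∀ p ∈ U, 0 < p.1)
    (hX : ∀ l : Fin 2, ContDiffOn ℝ (⊤ : ℕ∞) (fun q => X q l) U)
    (hkill : ∀ p ∈ U, IsAffineKillingAt C X p) {p : ℝ × ℝ} (hp : p ∈ U) (j l : Fin 2) :
    p.1 * (curv C j l * (pd 0 (fun q => X q 0) p + pd 1 (fun q => X q 1) p)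
      + curv C 0 l * pd j (fun q => X q 0) p + curv C 1 l * pd j (fun q => X q 1) p
      - curv C j 0 * pd 0 (fun q => X q l) p - curv C j 1 * pd 1 (fun q => X q l) p)
      - 2 * curv C j l * X p 0 = 0 := by
  have K := fun i j l => (hkill p hp).mul_sq (hU1 p hp) i j l
  have D0 := pd_killing hU hU1 hX hkill hp 0 1 j l
  have D1 := pd_killing hU hU1 hX hkill hp 1 0 j l
  have S := fun l => pd_comm hU (hX l) hp 1 0
  have T := pd_comm hU (contDiffOn_pd hU (hX l) j) hp 1 0
  simp only [Fin.sum_univ_two, if_true, one_ne_zero, if_false] at K D0 D1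
  simp only [curv]
  linear_combination p.1 * D0 - p.1 * D1 - 2 * K 1 j l
    + C 0 0 l * K 1 j 0 + C 0 1 l * K 1 j 1 - C 0 j 0 * K 1 0 l - C 0 j 1 * K 1 1 l
    - C 1 0 l * K 0 j 0 - C 1 1 l * K 0 j 1 + C 1 j 0 * K 0 0 l + C 1 j 1 * K 0 1 l
    + p.1 ^ 3 * T + p.1 ^ 2 * (C 0 j l * S 0 + C 1 j l * S 1)

/-- The Lie derivative of the symmetric Ricci tensor along an affine Killing field vanishes; in
normal form this is the Killing equation of `g₋`. -/
lemma lorentzian_killing {C : Fin 2 → Fin 2 → Fin 2 → ℝ} {lam : ℝ} (hlam : lam ≠ 0)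
    (hrho : rhoS C = lam • !![(1 : ℝ), 0; 0, -1]) {X : ℝ × ℝ → Fin 2 → ℝ}
    {U : Set (ℝ × ℝ)} (hU : IsOpen U) (hU1 : ∀ p ∈ U, 0 < p.1)
    (hX : ∀ l : Fin 2, ContDiffOn ℝ (⊤ : ℕ∞) (fun q => X q l) U)
    (hkill : ∀ p ∈ U, IsAffineKillingAt C X p) {p : ℝ × ℝ} (hp : p ∈ U) :
    p.1 * pd 0 (fun q => X q 0) p = X p 0 ∧ p.1 * pd 1 (fun q => X q 1) p = X p 0 ∧
      pd 0 (fun q => X q 1) p = pd 1 (fun q => X q 0) p := by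
  have hx := (hU1 p hp).ne'
  have L := lieDerivative_curv hU hU1 hX hkill hp
  have r11 : curv C 0 1 = -lam := by
    have h : rhoS C 0 0 = lam := by simp [hrho]
    simp only [rhoS, rhoC] at h
    simp at h
    simp only [curv]
    linear_combination -h
  have r12 : curv C 0 0 = curv C 1 1 := by
    have h : rhoS C 0 1 = 0 := by simp [hrho]
    simp only [rhoS, rhoC] at h
    simp at h
    simp only [curv]
    linear_combination h
  have r22 : curv C 1 0 = -lam := by
    have h : rhoS C 1 1 = -lam := by simp [hrho]
    simp only [rhoS, rhoC] at h
    simp at h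
    simp only [curv]
    linear_combination h
  have L00 := L 0 0
  have L01 := L 0 1
  have L10 := L 1 0
  have L11 := L 1 1
  simp only [r11, r12, r22] at L00 L01 L10 L11
  refine ⟨?_, ?_, ?_⟩ <;> apply mul_left_cancel₀ hlam
  · linear_combination -L01 / 2
  · linear_combination -L10 / 2
  · apply mul_left_cancel₀ hx
    linear_combination (L11 - L00) / 2

/-- Away from the exceptional connection `C₋`, an affine Killing field has no component along the
third Killing field `2x¹x²∂₁ + ((x¹)² + (x²)²)∂₂` of `g₋`. -/
lemma pd_one_zero_eq_zero {C : Fin 2 → Fin 2 → Fin 2 → ℝ} {lam : ℝ} (hlam : lam ≠ 0)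
    (hrho : rhoS C = lam • !![(1 : ℝ), 0; 0, -1]) (hC : C ≠ Cminus) {X : ℝ × ℝ → Fin 2 → ℝ}
    {U : Set (ℝ × ℝ)} (hU : IsOpen U) (hU1 : ∀ p ∈ U, 0 < p.1)
    (hX : ∀ l : Fin 2, ContDiffOn ℝ (⊤ : ℕ∞) (fun q => X q l) U)
    (hkill : ∀ p ∈ U, IsAffineKillingAt C X p) {p : ℝ × ℝ} (hp : p ∈ U) :
    pd 1 (fun q => X q 0) p = 0 := by
  have hx := (hU1 p hp).ne'
  have G := fun q (hq : q ∈ U) => lorentzian_killing hlam hrho hU hU1 hX hkill hq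
  obtain ⟨g11, g22, g12⟩ := G p hp
  have d : ∀ i k : Fin 2, DifferentiableAt ℝ (pd i fun q => X q k) p := fun i k =>
    differentiableAt_of_contDiffOn hU (contDiffOn_pd hU (hX k) i) hp
  have h11 := pd_congr_of_eqOn hU (fun q hq => (G q hq).1) hp
  have h22 := pd_congr_of_eqOn hU (fun q hq => (G q hq).2.1) hp
  have h12 := pd_congr_of_eqOn hU (fun q hq => (G q hq).2.2) hp
  have hfst : ∀ i, pd i (fun q : ℝ × ℝ => q.1) p = if i = 0 then 1 else 0 := fun i => pd_fst i p
  simp only [pd_mul differentiableAt_fst (d _ _), hfst] at h11 h22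
  have S := fun l => pd_comm hU (hX l) hp 1 0
  have H := fun i j l => (hkill p hp).mul_sq (hU1 p hp) i j l
  simp only [Fin.sum_univ_two] at H
  by_contra hv
  set v := pd 1 (fun q => X q 0) p
  simp only [mul_ite, mul_one, mul_zero] at h11 h22
  have s11 : p.1 * pd 0 (pd 0 fun q => X q 0) p = 0 := by simpa using h11 0
  have s12 : p.1 * pd 1 (pd 0 fun q => X q 0) p = v := by simpa using h11 1
  have s22 : p.1 * pd 1 (pd 1 fun q => X q 1) p = v := by simpa using h22 1
  have s21 : p.1 * pd 0 (pd 1 fun q => X q 1) p = 0 := by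
    have h := h22 0
    rw [if_pos rfl] at h
    apply mul_left_cancel₀ hx
    linear_combination p.1 * h + g11 - g22
  have t1 := h12 0
  have t2 := h12 1
  have hxv : p.1 * v ≠ 0 := mul_ne_zero hx hv
  have c000 : C 1 0 0 + C 0 1 0 - C 0 0 1 = 0 := by
    apply mul_left_cancel₀ hxv
    linear_combination H 0 0 0 - p.1 * s11 - C 0 0 0 * g11
      - p.1 * (C 1 0 0 + C 0 1 0) * g12
  have c010 : C 1 1 0 + C 0 0 0 - C 0 1 1 + 1 = 0 := by
    apply mul_left_cancel₀ hxv
    linear_combination H 0 1 0 - p.1 * (s12 - p.1 * S 0) - C 0 1 0 * g22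
      - p.1 * C 1 1 0 * g12
  have c100 : C 0 0 0 + C 1 1 0 - C 1 0 1 + 1 = 0 := by
    apply mul_left_cancel₀ hxv
    linear_combination H 1 0 0 - p.1 * s12 - C 1 0 0 * g22
      - p.1 * C 1 1 0 * g12
  have c110 : C 0 1 0 + C 1 0 0 - C 1 1 1 = 0 := by
    apply mul_left_cancel₀ hxv
    linear_combination H 1 1 0 - p.1 * (-p.1 * t2 + s21 + p.1 * S 1) - C 1 1 0 * (g22 + g22 - g11)
  have c001 : C 1 0 1 + C 0 1 1 - C 0 0 0 + 1 = 0 := by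
    apply mul_left_cancel₀ hxv
    linear_combination H 0 0 1 - p.1 * (p.1 * t1 + s12 - p.1 * S 0) - C 0 0 1 * (g11 + g11 - g22)
      - p.1 * (C 1 0 1 + C 0 1 1 - C 0 0 0) * g12
  have c011 : C 1 1 1 + C 0 0 1 - C 0 1 0 = 0 := by
    apply mul_left_cancel₀ hxv
    linear_combination H 0 1 1 - p.1 * s21 - C 0 1 1 * g11
      - p.1 * (C 1 1 1 - C 0 1 0) * g12
  have c101 : C 0 0 1 + C 1 1 1 - C 1 0 0 = 0 := by
    apply mul_left_cancel₀ hxv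
    linear_combination H 1 0 1 - p.1 * (s21 + p.1 * S 1) - C 1 0 1 * g11
      - p.1 * (C 1 1 1 - C 1 0 0) * g12
  have c111 : C 0 1 1 + C 1 0 1 - C 1 1 0 + 1 = 0 := by
    apply mul_left_cancel₀ hxv
    linear_combination H 1 1 1 - p.1 * s22 - C 1 1 1 * g22
      + p.1 * C 1 1 0 * g12
  apply hC
  funext i j l
  fin_cases i <;> fin_cases j <;> fin_cases l <;> simp [Cminus] <;> linarith

lemma exists_eq_const_of_pd_eq_zero {U : Set (ℝ × ℝ)} (hU : IsOpen U) (hUc : IsConnected U)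
    {f : ℝ × ℝ → ℝ} (hf : ∀ p ∈ U, DifferentiableAt ℝ f p)
    (h : ∀ p ∈ U, ∀ i, pd i f p = 0) : ∃ c, ∀ p ∈ U, f p = c := by
  refine hU.exists_is_const_of_fderiv_eq_zero hUc.isPreconnected
    (fun p hp => (hf p hp).differentiableWithinAt) fun p hp => ?_
  have h0 := h p hp 0
  have h1 := h p hp 1
  simp only [pd, if_true, one_ne_zero, if_false] at h0 h1
  ext <;> simp [h0, h1]

/-- If `ρ_{s,C} = λ·diag(1,−1)` with `λ ≠ 0` and `C ≠ C₋` (the Type C exception),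
then every smooth vector field on a connected open neighborhood of a point of the
half-plane `x¹ > 0` satisfying the affine Killing equation for `∇^C` lies in the
2-dimensional algebra `𝔥`, i.e. has the form `α(x¹∂₁ + x²∂₂) + β∂₂`. -/
theorem killing_fields_lorentzian_case (C : Fin 2 → Fin 2 → Fin 2 → ℝ) (lam : ℝ)
    (hlam : lam ≠ 0) (hrho : rhoS C = lam • !![(1 : ℝ), 0; 0, -1])
    (hC : C ≠ Cminus) (P : ℝ × ℝ) (hP : 0 < P.1)
    (U : Set (ℝ × ℝ)) (hUo : IsOpen U) (hUc : IsConnected U) (hPU : P ∈ U)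
    (hU1 : ∀ p ∈ U, 0 < p.1)
    (X : ℝ × ℝ → Fin 2 → ℝ) (hX : ∀ l : Fin 2, ContDiffOn ℝ (⊤ : ℕ∞) (fun q => X q l) U)
    (hkill : ∀ p ∈ U, IsAffineKillingAt C X p) :
    ∃ α β : ℝ, ∀ p ∈ U, X p 0 = α * p.1 ∧ X p 1 = α * p.2 + β := by
  have G := fun q (hq : q ∈ U) => lorentzian_killing hlam hrho hUo hU1 hX hkill hq
  have V := fun q (hq : q ∈ U) => pd_one_zero_eq_zero hlam hrho hC hUo hU1 hX hkill hq
  have W := fun q (hq : q ∈ U) => (G q hq).2.2.trans (V q hq)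
  have d : ∀ k : Fin 2, ∀ p ∈ U, DifferentiableAt ℝ (fun q => X q k) p := fun k p hp =>
    differentiableAt_of_contDiffOn hUo (hX k) hp
  have dd : ∀ i k : Fin 2, ∀ p ∈ U, DifferentiableAt ℝ (pd i fun q => X q k) p :=
    fun i k p hp => differentiableAt_of_contDiffOn hUo (contDiffOn_pd hUo (hX k) i) hp
  have pd_zero : ∀ (i : Fin 2) (p : ℝ × ℝ), pd i (fun _ => (0 : ℝ)) p = 0 := by simp [pd]
  obtain ⟨α, hα⟩ := exists_eq_const_of_pd_eq_zero hUo hUc (dd 0 0) fun p hp i => by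
    have hx := (hU1 p hp).ne'
    fin_cases i
    · have h := pd_congr_of_eqOn hUo (fun q hq => (G q hq).1) hp 0
      rw [pd_mul differentiableAt_fst (dd 0 0 p hp),
        show pd 0 (fun q : ℝ × ℝ => q.1) p = _ from pd_fst 0 p] at h
      apply mul_left_cancel₀ hx
      simpa using h
    · rw [Fin.mk_one, pd_comm hUo (hX 0) hp 1 0, pd_congr_of_eqOn hUo V hp, pd_zero]
  have hX1 : ∀ p ∈ U, pd 1 (fun q => X q 1) p = α := fun p hp => by
    rw [← hα p hp]
    exact mul_left_cancel₀ (hU1 p hp).ne' ((G p hp).2.1.trans (G p hp).1.symm)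
  obtain ⟨β, hβ⟩ := exists_eq_const_of_pd_eq_zero hUo hUc (f := fun q => X q 1 - α * q.2)
    (fun p hp => (d 1 p hp).fun_sub (by fun_prop)) fun p hp i => by
      have H := (d 1 p hp).hasFDerivAt.fun_sub
        ((hasFDerivAt_snd (𝕜 := ℝ) (E := ℝ) (F := ℝ) (p := p)).const_mul α)
      have h0 := W p hp
      have h1 := hX1 p hp
      simp only [pd, if_true, one_ne_zero, if_false] at h0 h1
      simp only [pd, H.fderiv]
      fin_cases i <;> simp [h0, h1]
  refine ⟨α, β, fun p hp => ⟨?_, ?_⟩⟩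
  · rw [← (G p hp).1, hα p hp, mul_comm]
  · linear_combination hβ p hp
end
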